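/- arXiv:1507.06541 — 2 statements merged into one kernel-verified Lean document; each statement's English description precedes it below -/
import Mathlib

section
/- Under the standing setup, assume additionally that no edge of M has both endpoints in N_2 and that no vertex of N_3 is adjacent to both endpoints of an edge whose two endpoints lie in N_4. Then every connected component of the subgraph induced by N_4(xy) is a single vertex, a single edge, or a triangle. -/
open SimpleGraph

/-- `M` is a dominating induced matching (d.i.m.) of `G`: every edge of `G` shares an
endpoint with exactly one edge of `M`. -/
def IsDIM {V : Type*} (G : SimpleGraph V) (M : Set (Sym2 V)) : Prop :=
  M ⊆ G.edgeSet ∧ ∀ e ∈ G.edgeSet, ∃! f, f ∈ M ∧ ∃ v, v ∈ e ∧ v ∈ f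

/-- `V(M)`: the set of endpoints of edges of `M`. -/
def MVerts {V : Type*} (M : Set (Sym2 V)) : Set V := {v | ∃ e ∈ M, v ∈ e}

/-- The distance level `N_i(xy) = {z | dist(z,{x,y}) = i}`. -/
def distLevel {V : Type*} (G : SimpleGraph V) (x y : V) (i : ℕ) : Set V :=
  {z : V | min (G.dist z x) (G.dist z y) = i}

/-- `c` lists the vertices of a chordless (induced) cycle of length `n` in `G`. -/
def IsInducedCycle {V : Type*} (G : SimpleGraph V) (n : ℕ) (c : ZMod n → V) : Prop :=
  Function.Injective c ∧ ∀ i j : ZMod n, G.Adj (c i) (c j) ↔ (j = i + 1 ∨ i = j + 1)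

/-- The diamond: vertices 0,1,2,3 and edges 01,02,12,13,23 (mid-edge 12). -/
def diamondGraph : SimpleGraph (Fin 4) :=
  SimpleGraph.fromEdgeSet {s(0,1), s(0,2), s(1,2), s(1,3), s(2,3)}

/-- The butterfly: vertices 0,1,2,3,4 and edges 01,02,12,23,24,34. -/
def butterflyGraph : SimpleGraph (Fin 5) :=
  SimpleGraph.fromEdgeSet {s(0,1), s(0,2), s(1,2), s(2,3), s(2,4), s(3,4)}

/-- The gem: a path 0-1-2-3 plus the universal vertex 4. -/
def gemGraph : SimpleGraph (Fin 5) :=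
  SimpleGraph.fromEdgeSet {s(0,1), s(1,2), s(2,3), s(4,0), s(4,1), s(4,2), s(4,3)}

/-- `T_w`: the vertices of `N_3(xy)` whose neighborhood in `N_2(xy)` is exactly `{w}`. -/
def Tset {V : Type*} (G : SimpleGraph V) (x y : V) (w : V) : Set V :=
  {t | t ∈ distLevel G x y 3 ∧ G.neighborSet t ∩ distLevel G x y 2 = {w}}

/-- The vertices distinct from and nonadjacent to both `t1` and `t2`
(the vertex set of `G'`). -/
def avoidSet {V : Type*} (G : SimpleGraph V) (t1 t2 : V) : Set V :=
  {v | v ≠ t1 ∧ v ≠ t2 ∧ ¬ G.Adj v t1 ∧ ¬ G.Adj v t2}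

section DominatingInducedMatching

variable {V : Type*} {G : SimpleGraph V}

/-- The distance of `z` from the set `{x, y}`. -/
noncomputable def edgeDist (G : SimpleGraph V) (x y z : V) : ℕ := min (G.dist z x) (G.dist z y)

lemma edgeDist_le_of_adj (hconn : G.Connected) (x y : V) {u v : V} (h : G.Adj u v) :
    edgeDist G x y u ≤ edgeDist G x y v + 1 := by
  have h1 := hconn.dist_triangle (u := u) (v := v) (w := x)
  have h2 := hconn.dist_triangle (u := u) (v := v) (w := y)
  have h3 : G.dist u v = 1 := SimpleGraph.dist_eq_one_iff_adj.mpr h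
  unfold edgeDist
  omega

lemma exists_adj_dist_eq (hconn : G.Connected) {x v : V} {n : ℕ} (h : G.dist v x = n + 1) :
    ∃ u, G.Adj v u ∧ G.dist u x = n := by
  obtain ⟨p, hp⟩ := hconn.exists_walk_length_eq_dist v x
  cases p with
  | nil => simp at h
  | @cons _ u _ hvu q =>
    refine ⟨u, hvu, ?_⟩
    have h1 := SimpleGraph.dist_le q
    have h2 := hconn.dist_triangle (u := v) (v := u) (w := x)
    have h3 : G.dist v u = 1 := SimpleGraph.dist_eq_one_iff_adj.mpr hvu
    simp only [SimpleGraph.Walk.length_cons] at hp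
    omega

lemma exists_adj_edgeDist_eq (hconn : G.Connected) {x y v : V} {n : ℕ}
    (h : edgeDist G x y v = n + 1) : ∃ u, G.Adj v u ∧ edgeDist G x y u = n := by
  have key : ∃ u, G.Adj v u ∧ edgeDist G x y u ≤ n := by
    rcases min_choice (G.dist v x) (G.dist v y) with h' | h'
    · obtain ⟨u, hu, hd⟩ := exists_adj_dist_eq hconn (h'.symm.trans h)
      exact ⟨u, hu, (min_le_left _ _).trans hd.le⟩
    · obtain ⟨u, hu, hd⟩ := exists_adj_dist_eq hconn (h'.symm.trans h)
      exact ⟨u, hu, (min_le_right _ _).trans hd.le⟩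
  obtain ⟨u, hu, hd⟩ := key
  have := edgeDist_le_of_adj hconn x y hu
  exact ⟨u, hu, by omega⟩

lemma eq_or_eq_of_edgeDist_eq_zero (hconn : G.Connected) {x y v : V}
    (h : edgeDist G x y v = 0) : v = x ∨ v = y := by
  rcases min_choice (G.dist v x) (G.dist v y) with h' | h'
  · exact Or.inl (hconn.dist_eq_zero_iff.mp (h'.symm.trans h))
  · exact Or.inr (hconn.dist_eq_zero_iff.mp (h'.symm.trans h))

lemma false_of_induced_P8 (hP8 : IsEmpty (SimpleGraph.pathGraph 8 ↪g G)) (f : Fin 8 → V)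
    (hadj : ∀ i j : Fin 8, i.val + 1 = j.val → G.Adj (f i) (f j))
    (hnadj : ∀ i j : Fin 8, i.val + 1 < j.val → ¬ G.Adj (f i) (f j)) : False := by
  have hiff : ∀ i j, G.Adj (f i) (f j) ↔ (SimpleGraph.pathGraph 8).Adj i j := by
    intro i j
    rw [SimpleGraph.pathGraph_adj]
    constructor
    · intro h
      by_contra! hc
      rcases lt_trichotomy i.val j.val with hl | hl | hl
      · exact hnadj i j (by omega) h
      · exact h.ne (congrArg f (Fin.ext hl))
      · exact hnadj j i (by omega) h.symm
    · rintro (h | h)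
      · exact hadj i j h
      · exact (hadj j i h).symm
  have htwin : ∀ i j : Fin 8,
      (∀ k : Fin 8, (i.val + 1 = k.val ∨ k.val + 1 = i.val) ↔
        (j.val + 1 = k.val ∨ k.val + 1 = j.val)) → i = j := by decide
  have hinj : Function.Injective f := by
    intro i j hij
    refine htwin i j fun k => ?_
    rw [← SimpleGraph.pathGraph_adj, ← SimpleGraph.pathGraph_adj, ← hiff, ← hiff, hij]
  exact hP8.false ⟨⟨f, hinj⟩, fun {a b} => hiff a b⟩

lemma false_of_K4 (hK4 : IsEmpty ((⊤ : SimpleGraph (Fin 4)) ↪g G)) {a b c d : V}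
    (hab : G.Adj a b) (hac : G.Adj a c) (had : G.Adj a d) (hbc : G.Adj b c) (hbd : G.Adj b d)
    (hcd : G.Adj c d) : False := by
  have hadj : ∀ i j : Fin 4, i < j → G.Adj (![a, b, c, d] i) (![a, b, c, d] j) := by
    intro i j hij
    fin_cases i <;> fin_cases j <;> first | (exfalso; revert hij; decide) | simpa
  have hne : ∀ i j : Fin 4, i ≠ j → G.Adj (![a, b, c, d] i) (![a, b, c, d] j) := by
    intro i j hij
    rcases lt_or_gt_of_ne hij with h | h
    · exact hadj i j h
    · exact (hadj j i h).symm
  refine hK4.false ⟨⟨![a, b, c, d], fun i j hij => ?_⟩, fun {i j} => ?_⟩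
  · by_contra h
    exact (hne i j h).ne hij
  · rw [SimpleGraph.top_adj]
    exact ⟨fun h hij => h.ne (congrArg _ hij), hne i j⟩

lemma false_of_induced_diamond (hDia : IsEmpty (diamondGraph ↪g G)) {a b c d : V}
    (hab : G.Adj a b) (hac : G.Adj a c) (hbc : G.Adj b c) (hbd : G.Adj b d) (hcd : G.Adj c d)
    (hne : a ≠ d) (had : ¬ G.Adj a d) : False := by
  have hda : ¬ G.Adj d a := fun h => had h.symm
  refine hDia.false ⟨⟨![a, b, c, d], fun i j hij => ?_⟩, fun {i j} => ?_⟩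
  · fin_cases i <;> fin_cases j <;>
      simp_all [hab.ne, hab.ne', hac.ne, hac.ne', hbc.ne, hbc.ne', hbd.ne, hbd.ne', hcd.ne,
        hcd.ne', hne.symm]
  · change G.Adj (![a, b, c, d] i) (![a, b, c, d] j) ↔ _
    fin_cases i <;> fin_cases j <;>
      simp [diamondGraph, hab, hab.symm, hac, hac.symm, hbc, hbc.symm, hbd, hbd.symm, hcd,
        hcd.symm, had, hda]

lemma false_of_induced_butterfly (hBut : IsEmpty (butterflyGraph ↪g G)) {a b c d e : V}
    (hab : G.Adj a b) (hac : G.Adj a c) (hbc : G.Adj b c) (hcd : G.Adj c d) (hce : G.Adj c e)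
    (hde : G.Adj d e) (had : ¬ G.Adj a d) (hae : ¬ G.Adj a e) (hbd : ¬ G.Adj b d)
    (hbe : ¬ G.Adj b e) : False := by
  have hda : ¬ G.Adj d a := fun h => had h.symm
  have hea : ¬ G.Adj e a := fun h => hae h.symm
  have hdb : ¬ G.Adj d b := fun h => hbd h.symm
  have heb : ¬ G.Adj e b := fun h => hbe h.symm
  have h1 : a ≠ d := by rintro rfl; exact hae hde
  have h2 : a ≠ e := by rintro rfl; exact had hde.symm
  have h3 : b ≠ d := by rintro rfl; exact hbe hde
  have h4 : b ≠ e := by rintro rfl; exact hbd hde.symm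
  refine hBut.false ⟨⟨![a, b, c, d, e], fun i j hij => ?_⟩, fun {i j} => ?_⟩
  · have := hab.ne
    have := hac.ne
    have := hbc.ne
    have := hcd.ne
    have := hce.ne
    have := hde.ne
    fin_cases i <;> fin_cases j <;> simp at hij ⊢ <;> grind
  · change G.Adj (![a, b, c, d, e] i) (![a, b, c, d, e] j) ↔ _
    fin_cases i <;> fin_cases j <;>
      simp [butterflyGraph, hab, hab.symm, hac, hac.symm, hbc, hbc.symm, hcd, hcd.symm, hce,
        hce.symm, hde, hde.symm, had, hda, hae, hea, hbd, hdb, hbe, heb]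

variable {M : Set (Sym2 V)}

lemma IsDIM.adj (hM : IsDIM G M) {a b : V} (h : s(a, b) ∈ M) : G.Adj a b := hM.1 h

lemma IsDIM.exists_mate (hM : IsDIM G M) {u v : V} (h : G.Adj u v) :
    (∃ w, s(u, w) ∈ M) ∨ ∃ w, s(v, w) ∈ M := by
  obtain ⟨f, ⟨hf, z, hz, hzf⟩, -⟩ := hM.2 s(u, v) h
  obtain ⟨w, rfl⟩ := Sym2.mem_iff_exists.mp hzf
  rcases Sym2.mem_iff.mp hz with rfl | rfl
  · exact Or.inl ⟨w, hf⟩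
  · exact Or.inr ⟨w, hf⟩

lemma IsDIM.eq_of_adj (hM : IsDIM G M) {a b c d : V} (hab : s(a, b) ∈ M) (hcd : s(c, d) ∈ M)
    (h : G.Adj a c) : s(a, b) = s(c, d) :=
  (hM.2 s(a, c) h).unique ⟨hab, a, by simp, by simp⟩ ⟨hcd, c, by simp, by simp⟩

lemma IsDIM.mate_unique (hM : IsDIM G M) {a b c : V} (hab : s(a, b) ∈ M) (hac : s(a, c) ∈ M) :
    b = c := by
  have := (hM.2 s(a, b) (hM.adj hab)).unique ⟨hab, a, by simp, by simp⟩ ⟨hac, a, by simp, by simp⟩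
  exact Sym2.congr_right.mp this

/-- Adjacent vertices that are both covered by `M` are matched with each other. -/
lemma IsDIM.mem_of_adj (hM : IsDIM G M) {a b c d : V} (hab : s(a, b) ∈ M) (hcd : s(c, d) ∈ M)
    (h : G.Adj a c) : s(a, c) ∈ M := by
  have h1 := hM.eq_of_adj hab hcd h
  have h2 : c ∈ s(a, b) := h1 ▸ Sym2.mem_mk_left c d
  rcases Sym2.mem_iff.mp h2 with rfl | rfl
  · exact absurd h G.irrefl
  · exact hab

/-- A vertex of the first level is not covered by `M`. -/
lemma IsDIM.not_mem_of_edgeDist_eq_one (hconn : G.Connected) (hM : IsDIM G M) {x y : V}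
    (hxy : s(x, y) ∈ M) {c w : V} (hc : edgeDist G x y c = 1) : s(c, w) ∉ M := by
  intro hcw
  have hcx : c ≠ x := by rintro rfl; simp [edgeDist] at hc
  have hcy : c ≠ y := by rintro rfl; simp [edgeDist] at hc
  obtain ⟨u, hu, hu0⟩ := exists_adj_edgeDist_eq hconn hc
  rcases eq_or_eq_of_edgeDist_eq_zero hconn hu0 with rfl | rfl
  · exact hcy (hM.mate_unique (Sym2.eq_swap ▸ hM.mem_of_adj hcw hxy hu) hxy)
  · rw [Sym2.eq_swap] at hxy
    exact hcx (hM.mate_unique (Sym2.eq_swap ▸ hM.mem_of_adj hcw hxy hu) hxy)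

lemma IsDIM.not_adj_of_edgeDist_eq_one (hconn : G.Connected) (hM : IsDIM G M) {x y : V}
    (hxy : s(x, y) ∈ M) {c d : V} (hc : edgeDist G x y c = 1) (hd : edgeDist G x y d = 1) :
    ¬ G.Adj c d := by
  intro h
  rcases hM.exists_mate h with ⟨w, hw⟩ | ⟨w, hw⟩
  · exact hM.not_mem_of_edgeDist_eq_one hconn hxy hc hw
  · exact hM.not_mem_of_edgeDist_eq_one hconn hxy hd hw

/-- A matching edge at a vertex of the third level leads to the second level. -/
lemma IsDIM.edgeDist_mate_eq_two (hconn : G.Connected) (hM : IsDIM G M) {x y : V}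
    (hxy : s(x, y) ∈ M) {a w : V} (ha : edgeDist G x y a = 3) (haw : s(a, w) ∈ M) : edgeDist G x y w = 2 := by
  obtain ⟨b, hab, hb⟩ := exists_adj_edgeDist_eq hconn ha
  obtain ⟨c, hbc, hc⟩ := exists_adj_edgeDist_eq hconn hb
  rcases hM.exists_mate hbc with ⟨u, hu⟩ | ⟨u, hu⟩
  · rwa [hM.mate_unique haw (hM.mem_of_adj haw hu hab)]
  · exact absurd hu (hM.not_mem_of_edgeDist_eq_one hconn hxy hc)

/-- Every vertex of the third level is an end of an induced `P₅` whose other vertices lie in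
lower levels. -/
lemma IsDIM.exists_induced_P5 (hconn : G.Connected) (hM : IsDIM G M) {x y r : V}
    (hxy : s(x, y) ∈ M) (hrx : G.Adj r x) (hry : r ≠ y) (hrny : ¬ G.Adj r y)
    {a : V} (ha : edgeDist G x y a = 3) :
    ∃ b c d e, G.Adj a b ∧ G.Adj b c ∧ G.Adj c d ∧ G.Adj d e ∧ ¬ G.Adj b d ∧ ¬ G.Adj b e ∧
      ¬ G.Adj c e ∧ edgeDist G x y b = 2 ∧ edgeDist G x y c = 1 ∧ edgeDist G x y d ≤ 1 ∧
      edgeDist G x y e ≤ 1 := by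
  have adj := hM.adj hxy
  have hx : edgeDist G x y x = 0 := by simp [edgeDist]
  have hy : edgeDist G x y y = 0 := by simp [edgeDist]
  have hr : edgeDist G x y r = 1 := by
    have h1 := edgeDist_le_of_adj hconn x y hrx
    have h2 : edgeDist G x y r ≠ 0 := fun h =>
      (eq_or_eq_of_edgeDist_eq_zero hconn h).elim hrx.ne hry
    omega
  obtain ⟨b, hab, hb⟩ := exists_adj_edgeDist_eq hconn ha
  obtain ⟨c, hbc, hc⟩ := exists_adj_edgeDist_eq hconn hb
  have hbx : ¬ G.Adj b x := fun h => by have := edgeDist_le_of_adj hconn x y h; omega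
  have hby : ¬ G.Adj b y := fun h => by have := edgeDist_le_of_adj hconn x y h; omega
  by_cases hcx : G.Adj c x
  · by_cases hcy : G.Adj c y
    · by_cases hbr : G.Adj b r
      · exact ⟨b, r, x, y, hab, hbr, hrx, adj, hbx, hby, hrny, hb, hr, by omega, by omega⟩
      · exact ⟨b, c, x, r, hab, hbc, hcx, hrx.symm, hbx, hbr,
          hM.not_adj_of_edgeDist_eq_one hconn hxy hc hr, hb, hc, by omega, by omega⟩
    · exact ⟨b, c, x, y, hab, hbc, hcx, adj, hbx, hby, hcy, hb, hc, by omega, by omega⟩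
  · obtain ⟨u, hu, hu0⟩ := exists_adj_edgeDist_eq hconn hc
    rcases eq_or_eq_of_edgeDist_eq_zero hconn hu0 with rfl | rfl
    · exact absurd hu hcx
    · exact ⟨b, c, u, x, hab, hbc, hu, adj.symm, hby, hbx, hcx, hb, hc, by omega, by omega⟩

/-- No induced `P₄` starts in the third level and continues in higher levels. -/
lemma IsDIM.not_induced_P4 (hconn : G.Connected) (hP8 : IsEmpty (SimpleGraph.pathGraph 8 ↪g G))
    (hM : IsDIM G M) {x y r : V}
    (hxy : s(x, y) ∈ M) (hrx : G.Adj r x) (hry : r ≠ y) (hrny : ¬ G.Adj r y)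
    {a u v w : V} (ha : edgeDist G x y a = 3) (hu : 4 ≤ edgeDist G x y u)
    (hv : 4 ≤ edgeDist G x y v) (hw : 4 ≤ edgeDist G x y w)
    (hau : G.Adj a u) (huv : G.Adj u v) (hvw : G.Adj v w)
    (hav : ¬ G.Adj a v) (haw : ¬ G.Adj a w) (huw : ¬ G.Adj u w) : False := by
  obtain ⟨b, c, d, e, hab, hbc, hcd, hde, hbd, hbe, hce, hb, hc, hd, he⟩ :=
    hM.exists_induced_P5 hconn hxy hrx hry hrny ha
  have far : ∀ p q, edgeDist G x y p + 1 < edgeDist G x y q → ¬ G.Adj q p := fun p q h h' => by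
    have := edgeDist_le_of_adj hconn x y h'
    omega
  refine false_of_induced_P8 hP8 ![w, v, u, a, b, c, d, e] ?_ ?_
  · intro i j hij
    fin_cases i <;> fin_cases j <;>
      first | (exfalso; revert hij; decide) | simpa [SimpleGraph.adj_comm]
  · intro i j hij
    fin_cases i <;> fin_cases j <;>
      first
      | (exfalso; revert hij; decide)
      | exact far _ _ (by simp; omega)
      | assumption
      | (rw [SimpleGraph.adj_comm]; assumption)

/-- The subgraph induced by the fourth level is `P₃`-free. -/
lemma IsDIM.adj_of_edgeDist_eq_four (hconn : G.Connected)
    (hP8 : IsEmpty (SimpleGraph.pathGraph 8 ↪g G))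
    (hDia : IsEmpty (diamondGraph ↪g G)) (hBut : IsEmpty (butterflyGraph ↪g G))
    (hM : IsDIM G M) {x y r : V}
    (hxy : s(x, y) ∈ M) (hrx : G.Adj r x) (hry : r ≠ y) (hrny : ¬ G.Adj r y)
    (hTri : ∀ a b c, edgeDist G x y a = 3 → edgeDist G x y b = 4 → edgeDist G x y c = 4 →
      G.Adj b c → G.Adj a b → ¬ G.Adj a c)
    {u v w : V} (hu : edgeDist G x y u = 4) (hv : edgeDist G x y v = 4)
    (hw : edgeDist G x y w = 4) (huv : G.Adj u v) (hvw : G.Adj v w) (hne : u ≠ w) :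
    G.Adj u w := by
  by_contra huw
  have hwu : ¬ G.Adj w u := fun h => huw h.symm
  have noP4 {a u v w : V} := hM.not_induced_P4 hconn hP8 hxy hrx hry hrny (a := a) (u := u)
    (v := v) (w := w)
  obtain ⟨a, hua, ha⟩ := exists_adj_edgeDist_eq hconn hu
  obtain ⟨b, hvb, hb⟩ := exists_adj_edgeDist_eq hconn hv
  have hav : ¬ G.Adj a v := hTri a u v ha hu hv huv hua.symm
  have haw : G.Adj a w := by
    by_contra haw
    exact noP4 ha hu.ge hv.ge hw.ge hua.symm huv hvw hav haw huw
  have hbu : ¬ G.Adj b u := hTri b v u hb hv hu huv.symm hvb.symm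
  have hbw : ¬ G.Adj b w := hTri b v w hb hv hw hvw hvb.symm
  have mate_level : ∀ {p q : V}, edgeDist G x y p = 4 → s(p, q) ∈ M → 4 ≤ edgeDist G x y q := by
    intro p q hp hpq
    by_contra hq
    have h1 := edgeDist_le_of_adj hconn x y (hM.adj hpq)
    have := hM.edgeDist_mate_eq_two hconn hxy (a := q) (w := p) (by omega) (Sym2.eq_swap ▸ hpq)
    omega
  have mate_nadj : ∀ {p q z z' : V}, 4 ≤ edgeDist G x y q → s(q, p) ∈ M →
      edgeDist G x y z = 3 → s(z, z') ∈ M → ¬ G.Adj z q := by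
    intro p q z z' hq hqp hz hzz h
    have := hM.edgeDist_mate_eq_two hconn hxy hz (hM.mem_of_adj hzz hqp h)
    omega
  by_cases hvM : ∃ v', s(v, v') ∈ M
  · obtain ⟨v', hv'⟩ := hvM
    have hv'4 := mate_level hv hv'
    have hv'v : s(v', v) ∈ M := Sym2.eq_swap ▸ hv'
    have haM : ∃ a', s(a, a') ∈ M := by
      by_contra haM
      obtain ⟨u', hu'⟩ := (hM.exists_mate hua).resolve_right haM
      obtain ⟨w', hw'⟩ := (hM.exists_mate haw).resolve_left haM
      exact hne (hM.mate_unique (Sym2.eq_swap ▸ hM.mem_of_adj hu' hv' huv)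
        (hM.mem_of_adj hv' hw' hvw))
    obtain ⟨a', ha'⟩ := haM
    have hav' := mate_nadj hv'4 hv'v ha ha'
    have huv' : G.Adj u v' := by
      by_contra h
      exact noP4 ha hu.ge hv.ge hv'4 hua.symm huv (hM.adj hv') hav hav' h
    have hwv' : G.Adj w v' := by
      by_contra h
      exact noP4 ha hw.ge hv.ge hv'4 haw hvw.symm (hM.adj hv') hav hav' h
    exact false_of_induced_diamond hDia huv huv' (hM.adj hv') hvw hwv'.symm hne huw
  · obtain ⟨b', hb'⟩ := (hM.exists_mate hvb).resolve_left hvM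
    obtain ⟨u', hu'⟩ := (hM.exists_mate huv).resolve_right hvM
    obtain ⟨w', hw'⟩ := (hM.exists_mate hvw).resolve_left hvM
    have hu'u : s(u', u) ∈ M := Sym2.eq_swap ▸ hu'
    have hw'w : s(w', w) ∈ M := Sym2.eq_swap ▸ hw'
    have hvu' : G.Adj v u' := by
      by_contra h
      exact noP4 hb hv.ge hu.ge (mate_level hu hu') hvb.symm huv.symm (hM.adj hu') hbu
        (mate_nadj (mate_level hu hu') hu'u hb hb') h
    have hvw' : G.Adj v w' := by
      by_contra h
      exact noP4 hb hv.ge hw.ge (mate_level hw hw') hvb.symm hvw (hM.adj hw') hbw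
        (mate_nadj (mate_level hw hw') hw'w hb hb') h
    have hu'w : ¬ G.Adj u' w := fun h => hne (hM.mate_unique hu'u (hM.mem_of_adj hu'u hw' h))
    have huw' : ¬ G.Adj u w' := fun h =>
      hne (hM.mate_unique (Sym2.eq_swap ▸ hM.mem_of_adj hu' hw'w h) hw'w)
    have hu'w' : ¬ G.Adj u' w' := fun h => by
      have := hM.mate_unique hu'u (hM.mem_of_adj hu'u hw'w h)
      exact huw (this ▸ (hM.adj hw').symm)
    exact false_of_induced_butterfly hBut (hM.adj hu') huv hvu'.symm hvw hvw' (hM.adj hw') huw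
      huw' hu'w hu'w'

/-- If adjacency is transitive on distinct vertices, then reachable distinct vertices are
adjacent. -/
lemma adj_of_reachable_of_P3_free {W : Type*} {H : SimpleGraph W}
    (htrans : ∀ u v w, H.Adj u v → H.Adj v w → u ≠ w → H.Adj u w) {u v : W}
    (h : H.Reachable u v) (hne : u ≠ v) : H.Adj u v := by
  obtain ⟨p⟩ := h
  induction p with
  | nil => exact absurd rfl hne
  | @cons a b c hab q ih =>
    by_cases hbc : b = c
    · exact hbc ▸ hab
    · exact htrans a b c hab (ih hbc) hne

end DominatingInducedMatching

/-- Corollary 3: under the standing setup, if no edge of `M` lies inside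
`N₂` and no vertex of `N₃` sees both endpoints of an edge inside `N₄`, then every
connected component of `G[N₄]` is a single vertex, an edge, or a triangle. -/
theorem stmt17 {V : Type*} [Fintype V] [DecidableEq V]
    (G : SimpleGraph V) (hconn : G.Connected)
    (hP8 : IsEmpty (SimpleGraph.pathGraph 8 ↪g G))
    (hK4 : IsEmpty ((⊤ : SimpleGraph (Fin 4)) ↪g G))
    (hDia : IsEmpty (diamondGraph ↪g G))
    (hBut : IsEmpty (butterflyGraph ↪g G))
    (M : Set (Sym2 V)) (hM : IsDIM G M)
    (x y : V) (hxy : s(x, y) ∈ M)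
    (r : V) (hrx : G.Adj r x) (hry : r ≠ y) (hrny : ¬ G.Adj r y)
    (hN2M : ∀ a b : V, a ∈ distLevel G x y 2 → b ∈ distLevel G x y 2 → s(a, b) ∉ M)
    (hTri : ∀ a ∈ distLevel G x y 3, ∀ b ∈ distLevel G x y 4, ∀ c ∈ distLevel G x y 4,
      G.Adj b c → ¬ (G.Adj a b ∧ G.Adj a c)) :
    ∀ C : (G.induce (distLevel G x y 4)).ConnectedComponent,
      (∃ a, C.supp = {a}) ∨
      (∃ a b, a ≠ b ∧ G.Adj a.1 b.1 ∧ C.supp = {a, b}) ∨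
      (∃ a b c, a ≠ b ∧ a ≠ c ∧ b ≠ c ∧
        G.Adj a.1 b.1 ∧ G.Adj a.1 c.1 ∧ G.Adj b.1 c.1 ∧ C.supp = {a, b, c}) := by
  intro C
  have hadj : ∀ p q, p ∈ C.supp → q ∈ C.supp → p ≠ q → G.Adj p.1 q.1 := by
    intro p q hp hq hpq
    have hreach := ConnectedComponent.exact (hp.trans hq.symm)
    refine adj_of_reachable_of_P3_free (H := G.induce (distLevel G x y 4))
      (fun u v w huv hvw huw => ?_) hreach hpq
    exact hM.adj_of_edgeDist_eq_four hconn hP8 hDia hBut hxy hrx hry hrny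
      (fun a b c ha hb hc hbc hab hac => hTri a ha b hb c hc hbc ⟨hab, hac⟩)
      u.2 v.2 w.2 huv hvw (Subtype.coe_ne_coe.mpr huw)
  obtain ⟨a, ha⟩ := C.nonempty_supp
  by_cases h1 : ∃ b ∈ C.supp, b ≠ a
  · obtain ⟨b, hb, hba⟩ := h1
    by_cases h2 : ∃ c ∈ C.supp, c ≠ a ∧ c ≠ b
    · obtain ⟨c, hc, hca, hcb⟩ := h2
      refine Or.inr (Or.inr ⟨a, b, c, hba.symm, hca.symm, hcb.symm, hadj a b ha hb hba.symm,
        hadj a c ha hc hca.symm, hadj b c hb hc hcb.symm, Set.Subset.antisymm ?_ ?_⟩)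
      · intro d hd
        by_contra hmem
        simp only [Set.mem_insert_iff, Set.mem_singleton_iff, not_or] at hmem
        obtain ⟨hda, hdb, hdc⟩ := hmem
        exact false_of_K4 hK4 (hadj a b ha hb hba.symm) (hadj a c ha hc hca.symm)
          (hadj a d ha hd (Ne.symm hda)) (hadj b c hb hc hcb.symm)
          (hadj b d hb hd (Ne.symm hdb)) (hadj c d hc hd (Ne.symm hdc))
      · rintro d (rfl | rfl | rfl) <;> assumption
    · push Not at h2
      refine Or.inr (Or.inl ⟨a, b, hba.symm, hadj a b ha hb hba.symm, Set.Subset.antisymm ?_ ?_⟩)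
      · intro d hd
        by_cases hda : d = a
        · exact Or.inl hda
        · exact Or.inr (h2 d hd hda)
      · rintro d (rfl | rfl) <;> assumption
  · push Not at h1
    exact Or.inl ⟨a, Set.Subset.antisymm (fun d hd => h1 d hd) (by rintro d rfl; exact ha)⟩
end

section
/- Under the standing setup with the sets T_i and S_3 as defined, assume additionally that no vertex of N_3 is adjacent to both endpoints of an edge whose two endpoints lie in N_4. Let {a,b,c} induce a triangle that is a connected component of G[N_4], and set A := N(a) ∩ N_3, B := N(b) ∩ N_3, C := N(c) ∩ N_3. Then: (i) A, B, C are pairwise disjoint independent sets; (ii) none of a, b, c has a neighbor in N_5; (iii) (A ∪ B ∪ C) ∩ S_3 = ∅; (iv) there exists j ∈ {1,…,k} with A ∪ B ∪ C ⊆ T_j. -/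
open SimpleGraph

/-- Eight vertices inducing a chordless path do not exist in a `P₈`-free graph. Distinctness of
the vertices is automatic, as distinct vertices of `P₈` have distinct neighborhoods. -/
theorem false_of_induced_path_eight {V : Type*} {G : SimpleGraph V}
    (hP8 : IsEmpty (SimpleGraph.pathGraph 8 ↪g G)) (f : Fin 8 → V)
    (hf : ∀ i j : Fin 8, i < j → (G.Adj (f i) (f j) ↔ i.val + 1 = j.val)) : False := by
  have hadj : ∀ i j : Fin 8, G.Adj (f i) (f j) ↔ (i.val + 1 = j.val ∨ j.val + 1 = i.val) := by
    intro i j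
    rcases lt_trichotomy i j with h | rfl | h
    · rw [hf i j h]; omega
    · simp
    · rw [G.adj_comm, hf j i h]; omega
  have htwin : ∀ i j : Fin 8,
      (∀ k : Fin 8, (i.val + 1 = k.val ∨ k.val + 1 = i.val) ↔
        (j.val + 1 = k.val ∨ k.val + 1 = j.val)) → i = j := by decide
  refine hP8.elim ⟨⟨f, fun i j hij => htwin i j fun k => ?_⟩, fun {i j} => ?_⟩
  · rw [← hadj, ← hadj, hij]
  · rw [SimpleGraph.pathGraph_adj]; exact hadj i j

section Levels

variable {V : Type*} {G : SimpleGraph V} {x y : V}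

theorem distLevel_adj_le (hconn : G.Connected) {p q : V} {i j : ℕ} (hp : p ∈ distLevel G x y i)
    (hq : q ∈ distLevel G x y j) (h : G.Adj p q) : i ≤ j + 1 := by
  have h1 := hconn.dist_triangle (u := p) (v := q) (w := x)
  have h2 := hconn.dist_triangle (u := p) (v := q) (w := y)
  rw [SimpleGraph.dist_eq_one_iff_adj.2 h] at h1 h2
  simp only [distLevel, Set.mem_ofPred_eq] at hp hq
  omega

theorem not_adj_of_distLevel (hconn : G.Connected) {p q : V} {i j : ℕ}
    (hp : p ∈ distLevel G x y i) (hq : q ∈ distLevel G x y j) (hij : i + 1 < j) :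
    ¬ G.Adj p q := fun h => by
  have := distLevel_adj_le hconn hq hp h.symm
  omega

theorem mem_distLevel_zero (hconn : G.Connected) {p : V} :
    p ∈ distLevel G x y 0 ↔ p = x ∨ p = y := by
  simp only [distLevel, Set.mem_ofPred_eq, ← hconn.dist_eq_zero_iff]
  omega

theorem exists_adj_dist_pred {p q : V} {n : ℕ} (hconn : G.Connected) (h : G.dist p q = n + 1) :
    ∃ t, G.Adj p t ∧ G.dist t q = n := by
  obtain ⟨w, hw⟩ := hconn.exists_walk_length_eq_dist p q
  cases w with
  | nil => simp at h
  | @cons _ t _ ht w =>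
    refine ⟨t, ht, ?_⟩
    have h1 := SimpleGraph.dist_le w
    have h2 := hconn.dist_triangle (u := p) (v := t) (w := q)
    rw [SimpleGraph.dist_eq_one_iff_adj.2 ht] at h2
    rw [SimpleGraph.Walk.length_cons] at hw
    omega

theorem exists_adj_distLevel_pred (hconn : G.Connected) {p : V} {n : ℕ}
    (hp : p ∈ distLevel G x y (n + 1)) : ∃ t ∈ distLevel G x y n, G.Adj p t := by
  have key : ∀ t, G.Adj p t → (G.dist t x = n ∨ G.dist t y = n) → t ∈ distLevel G x y n := by
    intro t ht h
    have hle := distLevel_adj_le hconn hp (q := t) rfl ht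
    simp only [distLevel, Set.mem_ofPred_eq]
    omega
  have hp' : min (G.dist p x) (G.dist p y) = n + 1 := hp
  rcases min_choice (G.dist p x) (G.dist p y) with h | h
  · obtain ⟨t, ht, htx⟩ := exists_adj_dist_pred hconn (h.symm.trans hp')
    exact ⟨t, key t ht (.inl htx), ht⟩
  · obtain ⟨t, ht, hty⟩ := exists_adj_dist_pred hconn (h.symm.trans hp')
    exact ⟨t, key t ht (.inr hty), ht⟩

theorem mem_distLevel_one_of_adj (hconn : G.Connected) {p : V} (hpx : p ≠ x) (hpy : p ≠ y)
    (h : G.Adj p x ∨ G.Adj p y) : p ∈ distLevel G x y 1 := by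
  have h1 : p ∉ distLevel G x y 0 := by
    rw [mem_distLevel_zero hconn]; tauto
  have h2 : G.dist p x = 1 ∨ G.dist p y = 1 := by
    simpa only [SimpleGraph.dist_eq_one_iff_adj] using h
  simp only [distLevel, Set.mem_ofPred_eq] at h1 ⊢
  omega

end Levels

namespace IsDIM

variable {V : Type*} {G : SimpleGraph V} {M : Set (Sym2 V)}

theorem adj_s18 (hM : IsDIM G M) {p q : V} (h : s(p, q) ∈ M) : G.Adj p q := hM.1 h

theorem mem_or_mem (hM : IsDIM G M) {p q : V} (h : G.Adj p q) :
    p ∈ MVerts M ∨ q ∈ MVerts M := by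
  obtain ⟨f, ⟨hf, v, hv, hvf⟩, -⟩ := hM.2 s(p, q) h
  rcases Sym2.mem_iff.1 hv with rfl | rfl
  · exact .inl ⟨f, hf, hvf⟩
  · exact .inr ⟨f, hf, hvf⟩

theorem mk_mem (hM : IsDIM G M) {p q : V} (h : G.Adj p q) (hp : p ∈ MVerts M)
    (hq : q ∈ MVerts M) : s(p, q) ∈ M := by
  obtain ⟨e, he, hpe⟩ := hp
  obtain ⟨f, hf, hqf⟩ := hq
  obtain rfl := (hM.2 s(p, q) h).unique ⟨he, p, by simp, hpe⟩ ⟨hf, q, by simp, hqf⟩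
  rwa [← (Sym2.mem_and_mem_iff h.ne).1 ⟨hpe, hqf⟩]

theorem mate_unique_s18 (hM : IsDIM G M) {p q t : V} (hq : s(p, q) ∈ M) (ht : s(p, t) ∈ M) :
    q = t := by
  have := (hM.2 s(p, q) (hM.adj_s18 hq)).unique ⟨hq, p, by simp, by simp⟩ ⟨ht, p, by simp, by simp⟩
  exact Sym2.congr_right.1 this

theorem eq_mate_of_adj (hM : IsDIM G M) {p q t : V} (hpq : s(p, q) ∈ M) (h : G.Adj p t)
    (ht : t ∈ MVerts M) : t = q :=
  hM.mate_unique_s18 (hM.mk_mem h ⟨_, hpq, by simp⟩ ht) hpq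

end IsDIM

section Setup

variable {V : Type*} {G : SimpleGraph V} {M : Set (Sym2 V)} {x y r : V}

theorem notMem_MVerts_of_distLevel_one (hconn : G.Connected) (hM : IsDIM G M)
    (hxy : s(x, y) ∈ M) {p : V} (hp : p ∈ distLevel G x y 1) : p ∉ MVerts M := by
  intro hpM
  have h0 : p ∉ distLevel G x y 0 := by
    intro h
    have h' : min (G.dist p x) (G.dist p y) = 1 := hp
    exact absurd (h'.symm.trans h) one_ne_zero
  rw [mem_distLevel_zero hconn] at h0
  obtain ⟨t, ht, hpt⟩ := exists_adj_distLevel_pred hconn hp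
  rcases (mem_distLevel_zero hconn).1 ht with rfl | rfl
  · exact h0 (.inr (hM.eq_mate_of_adj hxy hpt.symm hpM))
  · exact h0 (.inl (hM.eq_mate_of_adj (Sym2.eq_swap ▸ hxy) hpt.symm hpM))

theorem not_adj_of_distLevel_one (hconn : G.Connected) (hM : IsDIM G M)
    (hxy : s(x, y) ∈ M) {p q : V} (hp : p ∈ distLevel G x y 1) (hq : q ∈ distLevel G x y 1) :
    ¬ G.Adj p q := fun h =>
  (hM.mem_or_mem h).elim (notMem_MVerts_of_distLevel_one hconn hM hxy hp)
    (notMem_MVerts_of_distLevel_one hconn hM hxy hq)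

/-- Every vertex of `N₂` is the end of an induced `P₄` whose other vertices are in `N₀ ∪ N₁`. -/
theorem exists_tail (hconn : G.Connected) (hM : IsDIM G M) (hxy : s(x, y) ∈ M)
    (hrx : G.Adj r x) (hry : r ≠ y) (hrny : ¬ G.Adj r y) {u : V} (hu : u ∈ distLevel G x y 2) :
    ∃ w₁ w₂ w₃ : V, (∃ i < 2, w₁ ∈ distLevel G x y i) ∧ (∃ i < 2, w₂ ∈ distLevel G x y i) ∧
      (∃ i < 2, w₃ ∈ distLevel G x y i) ∧ G.Adj u w₁ ∧ G.Adj w₁ w₂ ∧ G.Adj w₂ w₃ ∧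
      ¬ G.Adj u w₂ ∧ ¬ G.Adj u w₃ ∧ ¬ G.Adj w₁ w₃ := by
  have hx0 : x ∈ distLevel G x y 0 := (mem_distLevel_zero hconn).2 (.inl rfl)
  have hy0 : y ∈ distLevel G x y 0 := (mem_distLevel_zero hconn).2 (.inr rfl)
  have hr1 : r ∈ distLevel G x y 1 := mem_distLevel_one_of_adj hconn hrx.ne hry (.inl hrx)
  have hux : ¬ G.Adj u x := fun h => not_adj_of_distLevel hconn hx0 hu (by omega) h.symm
  have huy : ¬ G.Adj u y := fun h => not_adj_of_distLevel hconn hy0 hu (by omega) h.symm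
  have hxyA := hM.adj_s18 hxy
  by_cases hur : G.Adj u r
  · exact ⟨r, x, y, ⟨1, by omega, hr1⟩, ⟨0, by omega, hx0⟩, ⟨0, by omega, hy0⟩, hur, hrx, hxyA,
      hux, huy, hrny⟩
  obtain ⟨w, hw, huw⟩ := exists_adj_distLevel_pred hconn hu
  obtain ⟨t, ht, hwt⟩ := exists_adj_distLevel_pred hconn hw
  have hwr := not_adj_of_distLevel_one hconn hM hxy hw hr1
  by_cases hwx : G.Adj w x
  · by_cases hwy : G.Adj w y
    · exact ⟨w, x, r, ⟨1, by omega, hw⟩, ⟨0, by omega, hx0⟩, ⟨1, by omega, hr1⟩, huw, hwx,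
        hrx.symm, hux, hur, hwr⟩
    · exact ⟨w, x, y, ⟨1, by omega, hw⟩, ⟨0, by omega, hx0⟩, ⟨0, by omega, hy0⟩, huw, hwx, hxyA,
        hux, huy, hwy⟩
  · rcases (mem_distLevel_zero hconn).1 ht with rfl | rfl
    · exact absurd hwt hwx
    · exact ⟨w, t, x, ⟨1, by omega, hw⟩, ⟨0, by omega, hy0⟩, ⟨0, by omega, hx0⟩, huw, hwt,
        hxyA.symm, huy, hux, hwx⟩

/-- No induced `P₅` starts in `N₂` and has its other vertices beyond `N₂`. -/
theorem false_of_path_above (hconn : G.Connected) (hP8 : IsEmpty (SimpleGraph.pathGraph 8 ↪g G))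
    (hM : IsDIM G M) (hxy : s(x, y) ∈ M)
    (hrx : G.Adj r x) (hry : r ≠ y) (hrny : ¬ G.Adj r y) {u v₁ v₂ v₃ v₄ : V}
    (hu : u ∈ distLevel G x y 2)
    (h₁ : ∃ i > 2, v₁ ∈ distLevel G x y i) (h₂ : ∃ i > 2, v₂ ∈ distLevel G x y i)
    (h₃ : ∃ i > 2, v₃ ∈ distLevel G x y i) (h₄ : ∃ i > 2, v₄ ∈ distLevel G x y i)
    (hu1 : G.Adj u v₁) (h12 : G.Adj v₁ v₂) (h23 : G.Adj v₂ v₃) (h34 : G.Adj v₃ v₄)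
    (hu2 : ¬ G.Adj u v₂) (hu3 : ¬ G.Adj u v₃) (hu4 : ¬ G.Adj u v₄)
    (h13 : ¬ G.Adj v₁ v₃) (h14 : ¬ G.Adj v₁ v₄) (h24 : ¬ G.Adj v₂ v₄) : False := by
  obtain ⟨w₁, w₂, w₃, k₁, k₂, k₃, a1, a2, a3, n1, n2, n3⟩ :=
    exists_tail hconn hM hxy hrx hry hrny hu
  have far : ∀ {w v : V}, (∃ i < 2, w ∈ distLevel G x y i) → (∃ i > 2, v ∈ distLevel G x y i) →
      ¬ G.Adj w v := by
    rintro w v ⟨i, hi, hw⟩ ⟨j, hj, hv⟩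
    exact not_adj_of_distLevel hconn hw hv (by omega)
  refine false_of_induced_path_eight hP8 ![w₃, w₂, w₁, u, v₁, v₂, v₃, v₄] ?_
  intro i j hij
  fin_cases i <;> fin_cases j <;> first
    | exact absurd hij (by decide)
    | simp [*, far k₁ h₁, far k₁ h₂, far k₁ h₃, far k₁ h₄, far k₂ h₁, far k₂ h₂, far k₂ h₃,
        far k₂ h₄, far k₃ h₁, far k₃ h₂, far k₃ h₃, far k₃ h₄, a1.symm, a2.symm, a3.symm,
        G.adj_comm w₂ u, G.adj_comm w₃ u, G.adj_comm w₃ w₁]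

theorem mem_distLevel_unique {p : V} {i j : ℕ} (hi : p ∈ distLevel G x y i)
    (hj : p ∈ distLevel G x y j) : i = j :=
  Eq.trans (Eq.symm hi) hj

theorem mem_distLevel_two_of_adj (hconn : G.Connected) (hM : IsDIM G M)
    (hN2 : ∀ u ∈ distLevel G x y 2, u ∈ MVerts M) {p t : V} (hp : p ∈ distLevel G x y 3)
    (hpM : p ∈ MVerts M) (h : G.Adj p t) (ht : t ∈ MVerts M) : t ∈ distLevel G x y 2 := by
  obtain ⟨u, hu, hpu⟩ := exists_adj_distLevel_pred hconn hp
  rwa [hM.eq_mate_of_adj (hM.mk_mem hpu hpM (hN2 u hu)) h ht]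

/-- A triangle with two vertices in `N₃` has its third vertex outside `N₄`. -/
theorem not_adj_of_common_neighbor (hconn : G.Connected) (hM : IsDIM G M)
    (hN2 : ∀ u ∈ distLevel G x y 2, u ∈ MVerts M) {t p q : V} (ht : t ∈ distLevel G x y 4)
    (hp : p ∈ distLevel G x y 3) (hq : q ∈ distLevel G x y 3) (htp : G.Adj t p)
    (htq : G.Adj t q) : ¬ G.Adj p q := by
  intro hpq
  have bad : ∀ {s w : V}, s ∈ distLevel G x y 3 → (w ∈ distLevel G x y 3 ∨ w ∈ distLevel G x y 4) →
      G.Adj s w → s ∈ MVerts M → w ∈ MVerts M → False := by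
    intro s w hs hw hsw hsM hwM
    have h2 := mem_distLevel_two_of_adj hconn hM hN2 hs hsM hsw hwM
    rcases hw with hw | hw
    · exact absurd (mem_distLevel_unique h2 hw) (by omega)
    · exact absurd (mem_distLevel_unique h2 hw) (by omega)
  have h1 := hM.mem_or_mem hpq
  have h2 := hM.mem_or_mem htp
  have h3 := hM.mem_or_mem htq
  have b1 := bad hp (.inl hq) hpq
  have b2 := bad hp (.inr ht) htp.symm
  have b3 := bad hq (.inr ht) htq.symm
  tauto

theorem not_adj_both_of_triangle (hK4 : IsEmpty ((⊤ : SimpleGraph (Fin 4)) ↪g G))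
    (hDia : IsEmpty (diamondGraph ↪g G)) {a b c z : V} (hab : G.Adj a b) (hac : G.Adj a c)
    (hbc : G.Adj b c) (hcz : c ≠ z) (haz : G.Adj a z) : ¬ G.Adj b z := by
  intro hbz
  have hinj : Function.Injective ![c, a, b, z] := by
    intro i j
    fin_cases i <;> fin_cases j <;>
      simp [hab.ne, hac.ne, hbc.ne, haz.ne, hbz.ne, hab.ne', hac.ne', hbc.ne', haz.ne', hbz.ne',
        hcz, hcz.symm]
  by_cases h : G.Adj c z
  · refine hK4.elim ⟨⟨![c, a, b, z], hinj⟩, fun {i j} => ?_⟩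
    fin_cases i <;> fin_cases j <;>
      simp [hab, hac, hbc, haz, hbz, hab.symm, hac.symm, hbc.symm, haz.symm, hbz.symm, h, h.symm]
  · refine hDia.elim ⟨⟨![c, a, b, z], hinj⟩, fun {i j} => ?_⟩
    fin_cases i <;> fin_cases j <;>
      simp [diamondGraph, hab, hac, hbc, haz, hbz, hab.symm, hac.symm, hbc.symm, haz.symm,
        hbz.symm, h, G.adj_comm z c]

theorem not_adj_distLevel_five (hconn : G.Connected)
    (hP8 : IsEmpty (SimpleGraph.pathGraph 8 ↪g G))
    (hK4 : IsEmpty ((⊤ : SimpleGraph (Fin 4)) ↪g G)) (hDia : IsEmpty (diamondGraph ↪g G))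
    (hM : IsDIM G M) (hxy : s(x, y) ∈ M)
    (hrx : G.Adj r x) (hry : r ≠ y) (hrny : ¬ G.Adj r y)
    (hTri : ∀ p ∈ distLevel G x y 3, ∀ q ∈ distLevel G x y 4, ∀ w ∈ distLevel G x y 4,
      G.Adj q w → ¬ (G.Adj p q ∧ G.Adj p w))
    {a b c z : V} (ha : a ∈ distLevel G x y 4) (hb : b ∈ distLevel G x y 4)
    (hc : c ∈ distLevel G x y 4) (hab : G.Adj a b) (hac : G.Adj a c) (hbc : G.Adj b c)
    (hz : z ∈ distLevel G x y 5) : ¬ G.Adj a z := by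
  intro haz
  have hcz : c ≠ z := by
    rintro rfl
    exact absurd (mem_distLevel_unique hc hz) (by omega)
  have hbz := not_adj_both_of_triangle hK4 hDia hab hac hbc hcz haz
  obtain ⟨p, hp, hbp⟩ := exists_adj_distLevel_pred hconn hb
  obtain ⟨u, hu, hpu⟩ := exists_adj_distLevel_pred hconn hp
  exact false_of_path_above hconn hP8 hM hxy hrx hry hrny hu ⟨3, by omega, hp⟩ ⟨4, by omega, hb⟩
    ⟨4, by omega, ha⟩ ⟨5, by omega, hz⟩ hpu.symm hbp.symm hab.symm haz
    (not_adj_of_distLevel hconn hu hb (by omega)) (not_adj_of_distLevel hconn hu ha (by omega))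
    (not_adj_of_distLevel hconn hu hz (by omega))
    (fun h => hTri p hp a ha b hb hab ⟨h, hbp.symm⟩)
    (not_adj_of_distLevel hconn hp hz (by omega)) hbz

theorem root_eq_root (hconn : G.Connected) (hP8 : IsEmpty (SimpleGraph.pathGraph 8 ↪g G))
    (hM : IsDIM G M) (hxy : s(x, y) ∈ M)
    (hrx : G.Adj r x) (hry : r ≠ y) (hrny : ¬ G.Adj r y)
    (hN2 : ∀ u ∈ distLevel G x y 2, u ∈ MVerts M)
    (hTri : ∀ p ∈ distLevel G x y 3, ∀ q ∈ distLevel G x y 4, ∀ w ∈ distLevel G x y 4,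
      G.Adj q w → ¬ (G.Adj p q ∧ G.Adj p w))
    {a b c p q u v : V} (ha : a ∈ distLevel G x y 4) (hb : b ∈ distLevel G x y 4)
    (hc : c ∈ distLevel G x y 4) (hab : G.Adj a b) (hac : G.Adj a c) (hbc : G.Adj b c)
    (haM : a ∉ MVerts M) (hp : p ∈ distLevel G x y 3) (hq : q ∈ distLevel G x y 3)
    (hpa : G.Adj p a) (hqb : G.Adj q b) (hu : u ∈ distLevel G x y 2)
    (hv : v ∈ distLevel G x y 2) (hpu : G.Adj p u) (hqv : G.Adj q v) : v = u := by
  by_contra hvu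
  have hpM := (hM.mem_or_mem hpa).resolve_right haM
  have hpv : ¬ G.Adj p v := fun h =>
    hvu (hM.eq_mate_of_adj (hM.mk_mem hpu hpM (hN2 u hu)) h (hN2 v hv))
  have hva := not_adj_of_distLevel hconn hv ha (by omega)
  have hqa : ¬ G.Adj q a := fun h => hTri q hq a ha b hb hab ⟨h, hqb⟩
  by_cases hqp : G.Adj q p
  · exact false_of_path_above hconn hP8 hM hxy hrx hry hrny hv ⟨3, by omega, hq⟩
      ⟨3, by omega, hp⟩ ⟨4, by omega, ha⟩ ⟨4, by omega, hc⟩ hqv.symm hqp hpa hac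
      (fun h => hpv h.symm) hva (not_adj_of_distLevel hconn hv hc (by omega)) hqa
      (fun h => hTri q hq b hb c hc hbc ⟨hqb, h⟩) (fun h => hTri p hp a ha c hc hac ⟨hpa, h⟩)
  · exact false_of_path_above hconn hP8 hM hxy hrx hry hrny hv ⟨3, by omega, hq⟩
      ⟨4, by omega, hb⟩ ⟨4, by omega, ha⟩ ⟨3, by omega, hp⟩ hqv.symm hqb hab.symm hpa.symm
      (not_adj_of_distLevel hconn hv hb (by omega)) hva (fun h => hpv h.symm) hqa hqp
      (fun h => hTri p hp a ha b hb hab ⟨hpa, h.symm⟩)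

/-- The `N₃`-neighbors of a triangle in `N₄`, one vertex of which is not covered by `M`, all have
the same single neighbor in `N₂`. -/
theorem exists_root (hconn : G.Connected) (hP8 : IsEmpty (SimpleGraph.pathGraph 8 ↪g G))
    (hM : IsDIM G M) (hxy : s(x, y) ∈ M)
    (hrx : G.Adj r x) (hry : r ≠ y) (hrny : ¬ G.Adj r y)
    (hN2 : ∀ u ∈ distLevel G x y 2, u ∈ MVerts M)
    (hTri : ∀ p ∈ distLevel G x y 3, ∀ q ∈ distLevel G x y 4, ∀ w ∈ distLevel G x y 4,
      G.Adj q w → ¬ (G.Adj p q ∧ G.Adj p w))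
    {a b c : V} (ha : a ∈ distLevel G x y 4) (hb : b ∈ distLevel G x y 4)
    (hc : c ∈ distLevel G x y 4) (hab : G.Adj a b) (hac : G.Adj a c) (hbc : G.Adj b c)
    (haM : a ∉ MVerts M) :
    ∃ u ∈ distLevel G x y 2, ∀ t ∈ distLevel G x y 3, (G.Adj a t ∨ G.Adj b t ∨ G.Adj c t) →
      ∀ v ∈ distLevel G x y 2, G.Adj t v → v = u := by
  obtain ⟨p, hp, hap⟩ := exists_adj_distLevel_pred hconn ha
  obtain ⟨u, hu, hpu⟩ := exists_adj_distLevel_pred hconn hp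
  obtain ⟨q, hq, hbq⟩ := exists_adj_distLevel_pred hconn hb
  obtain ⟨w, hw, hqw⟩ := exists_adj_distLevel_pred hconn hq
  have key := @root_eq_root V G M x y r hconn hP8 hM hxy hrx hry hrny hN2 hTri
  refine ⟨u, hu, ?_⟩
  rintro t ht (h | h | h) v hv htv
  · rw [← key ha hb hc hab hac hbc haM ht hq h.symm hbq.symm hv hw htv hqw,
      key ha hb hc hab hac hbc haM hp hq hap.symm hbq.symm hu hw hpu hqw]
  · exact key ha hb hc hab hac hbc haM hp ht hap.symm h.symm hu hv hpu htv
  · exact key ha hc hb hac hab hbc.symm haM hp ht hap.symm h.symm hu hv hpu htv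

theorem IsDIM.exists_notMem_of_triangle (hM : IsDIM G M) {a b c : V} (hab : G.Adj a b)
    (hac : G.Adj a c) (hbc : G.Adj b c) : a ∉ MVerts M ∨ b ∉ MVerts M ∨ c ∉ MVerts M := by
  by_contra! h
  obtain ⟨ha, hb, hc⟩ := h
  exact hbc.ne (hM.mate_unique_s18 (hM.mk_mem hab ha hb) (hM.mk_mem hac ha hc))

end Setup

/-- Lemma 7: for a triangle component `{a,b,c}` of `G[N₄]`, with
`A, B, C` the `N₃`-neighborhoods of `a, b, c`: (i) `A, B, C` are pairwise disjoint
independent sets; (ii) `a, b, c` have no neighbors in `N₅`; (iii) `(A ∪ B ∪ C) ∩ S₃ = ∅`;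
(iv) `A ∪ B ∪ C ⊆ T_j` for some `j`. -/
theorem stmt18 {V : Type*} [Fintype V] [DecidableEq V]
    (G : SimpleGraph V) (hconn : G.Connected)
    (hP8 : IsEmpty (SimpleGraph.pathGraph 8 ↪g G))
    (hK4 : IsEmpty ((⊤ : SimpleGraph (Fin 4)) ↪g G))
    (hDia : IsEmpty (diamondGraph ↪g G))
    (hBut : IsEmpty (butterflyGraph ↪g G))
    (M : Set (Sym2 V)) (hM : IsDIM G M)
    (x y : V) (hxy : s(x, y) ∈ M)
    (r : V) (hrx : G.Adj r x) (hry : r ≠ y) (hrny : ¬ G.Adj r y)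
    (hN2M : ∀ a b : V, a ∈ distLevel G x y 2 → b ∈ distLevel G x y 2 → s(a, b) ∉ M)
    (k : ℕ) (u : Fin k → V) (huinj : Function.Injective u)
    (hurange : Set.range u = distLevel G x y 2)
    (u' : Fin k → V) (hu3 : ∀ i, u' i ∈ distLevel G x y 3)
    (huM : ∀ i, s(u i, u' i) ∈ M)
    (hTri : ∀ p ∈ distLevel G x y 3, ∀ q ∈ distLevel G x y 4, ∀ w ∈ distLevel G x y 4,
      G.Adj q w → ¬ (G.Adj p q ∧ G.Adj p w))
    (a b c : V) (ha4 : a ∈ distLevel G x y 4) (hb4 : b ∈ distLevel G x y 4)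
    (hc4 : c ∈ distLevel G x y 4)
    (hab : G.Adj a b) (hac : G.Adj a c) (hbc : G.Adj b c)
    (hcomp : ∀ w ∈ distLevel G x y 4, (G.Adj w a ∨ G.Adj w b ∨ G.Adj w c) →
      w = a ∨ w = b ∨ w = c) :
    ((G.neighborSet a ∩ distLevel G x y 3) ∩ (G.neighborSet b ∩ distLevel G x y 3) = ∅ ∧
     (G.neighborSet a ∩ distLevel G x y 3) ∩ (G.neighborSet c ∩ distLevel G x y 3) = ∅ ∧
     (G.neighborSet b ∩ distLevel G x y 3) ∩ (G.neighborSet c ∩ distLevel G x y 3) = ∅ ∧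
     (∀ p ∈ G.neighborSet a ∩ distLevel G x y 3,
       ∀ q ∈ G.neighborSet a ∩ distLevel G x y 3, ¬ G.Adj p q) ∧
     (∀ p ∈ G.neighborSet b ∩ distLevel G x y 3,
       ∀ q ∈ G.neighborSet b ∩ distLevel G x y 3, ¬ G.Adj p q) ∧
     (∀ p ∈ G.neighborSet c ∩ distLevel G x y 3,
       ∀ q ∈ G.neighborSet c ∩ distLevel G x y 3, ¬ G.Adj p q)) ∧
    (∀ z ∈ distLevel G x y 5, ¬ G.Adj a z ∧ ¬ G.Adj b z ∧ ¬ G.Adj c z) ∧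
    (((G.neighborSet a ∪ G.neighborSet b ∪ G.neighborSet c) ∩ distLevel G x y 3) ∩
      (distLevel G x y 3 \ ⋃ i : Fin k, Tset G x y (u i)) = ∅) ∧
    (∃ j : Fin k, (G.neighborSet a ∪ G.neighborSet b ∪ G.neighborSet c) ∩
      distLevel G x y 3 ⊆ Tset G x y (u j)) := by
  have hN2 : ∀ v ∈ distLevel G x y 2, v ∈ MVerts M := by
    intro v hv
    obtain ⟨i, rfl⟩ := hurange ▸ hv
    exact ⟨_, huM i, by simp⟩
  have hdisj : ∀ {p q : V}, p ∈ distLevel G x y 4 → q ∈ distLevel G x y 4 → G.Adj p q →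
      (G.neighborSet p ∩ distLevel G x y 3) ∩ (G.neighborSet q ∩ distLevel G x y 3) = ∅ := by
    intro p q hp hq hpq
    refine Set.eq_empty_of_forall_notMem ?_
    rintro t ⟨⟨htp, ht⟩, htq, -⟩
    exact hTri t ht p hp q hq hpq ⟨htp.symm, htq.symm⟩
  have hindep : ∀ {s : V}, s ∈ distLevel G x y 4 → ∀ p ∈ G.neighborSet s ∩ distLevel G x y 3,
      ∀ q ∈ G.neighborSet s ∩ distLevel G x y 3, ¬ G.Adj p q :=
    fun hs p hp q hq => not_adj_of_common_neighbor hconn hM hN2 hs hp.2 hq.2 hp.1 hq.1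
  have hfive := @not_adj_distLevel_five V G M x y r hconn hP8 hK4 hDia hM hxy hrx hry hrny hTri
  have hroot := @exists_root V G M x y r hconn hP8 hM hxy hrx hry hrny hN2 hTri
  have hT : ∃ j : Fin k, (G.neighborSet a ∪ G.neighborSet b ∪ G.neighborSet c) ∩
      distLevel G x y 3 ⊆ Tset G x y (u j) := by
    obtain ⟨v, hv, hvt⟩ : ∃ v ∈ distLevel G x y 2, ∀ t ∈ distLevel G x y 3,
        (G.Adj a t ∨ G.Adj b t ∨ G.Adj c t) → ∀ w ∈ distLevel G x y 2, G.Adj t w → w = v := by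
      rcases hM.exists_notMem_of_triangle hab hac hbc with h | h | h
      · exact hroot ha4 hb4 hc4 hab hac hbc h
      · obtain ⟨v, hv, hvt⟩ := hroot hb4 ha4 hc4 hab.symm hbc hac h
        exact ⟨v, hv, fun t ht h => hvt t ht (by tauto)⟩
      · obtain ⟨v, hv, hvt⟩ := hroot hc4 ha4 hb4 hac.symm hbc.symm hab h
        exact ⟨v, hv, fun t ht h => hvt t ht (by tauto)⟩
    obtain ⟨j, rfl⟩ := hurange ▸ hv
    refine ⟨j, ?_⟩
    rintro t ⟨htn, ht⟩
    have huniq := hvt t ht (by rcases htn with (h | h) | h <;> simp_all)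
    obtain ⟨w, hw, htw⟩ := exists_adj_distLevel_pred hconn ht
    refine ⟨ht, Set.eq_singleton_iff_unique_mem.2 ⟨?_, fun s hs => huniq s hs.2 hs.1⟩⟩
    rw [← huniq w hw htw]
    exact ⟨htw, hw⟩
  refine ⟨⟨hdisj ha4 hb4 hab, hdisj ha4 hc4 hac, hdisj hb4 hc4 hbc, hindep ha4, hindep hb4,
    hindep hc4⟩, fun z hz => ⟨hfive ha4 hb4 hc4 hab hac hbc hz,
    hfive hb4 ha4 hc4 hab.symm hbc hac hz, hfive hc4 ha4 hb4 hac.symm hbc.symm hab hz⟩, ?_, hT⟩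
  obtain ⟨j, hj⟩ := hT
  refine Set.eq_empty_of_forall_notMem ?_
  rintro t ⟨ht, -, hnot⟩
  exact hnot (Set.mem_iUnion.2 ⟨j, hj ht⟩)
end
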